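/- For all BCI-terms L, M, N, the associativity law B L (B M N) =_BCI B (B L M) N is derivable from the BCI axioms. -/

import Mathlib

/-!
The linear combinatory logic `BCI` and the linear lambda calculus, with
the translations `(-)♯ : BCI → λ_lin` and `(-)♭ : λ_lin → BCI`
(Appendix A of Hasegawa, "The braided lambda calculus").
-/

namespace BCILin

/-- `BCI`-terms: variables, the constants `B`, `C`, `I`, and application. -/
inductive CT : Type
  | var : ℕ → CT
  | B : CT
  | C : CT
  | I : CT
  | app : CT → CT → CT

infixl:70 " ⬝ " => CT.app

/-- The list of (free) variables of a `BCI`-term. -/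
def cfv : CT → List ℕ
  | .var x => [x]
  | .app P Q => cfv P ++ cfv Q
  | _ => []

/-- A `BCI`-term is linear: every variable occurs at most once. -/
def CWF (P : CT) : Prop := (cfv P).Nodup

/-- `=_BCI`: the smallest congruence on `BCI`-terms satisfying the ten
axioms of Figure 6 (a complete axiomatization of `BCI`). -/
inductive CEq : CT → CT → Prop
  | refl (P : CT) : CEq P P
  | symm {P Q : CT} : CEq P Q → CEq Q P
  | trans {P Q R : CT} : CEq P Q → CEq Q R → CEq P R
  | app {P P' Q Q' : CT} : CEq P P' → CEq Q Q' → CEq (P ⬝ Q) (P' ⬝ Q')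
  | axB (L M N : CT) : CEq (.B ⬝ L ⬝ M ⬝ N) (L ⬝ (M ⬝ N))
  | axC (L M N : CT) : CEq (.C ⬝ L ⬝ M ⬝ N) (L ⬝ N ⬝ M)
  | axI (M : CT) : CEq (.I ⬝ M) M
  | axBI : CEq (.B ⬝ .I) .I
  | axCBI : CEq (.C ⬝ .B ⬝ .I) .I
  | ax6 : CEq (.B ⬝ (.B ⬝ .B) ⬝ .B) (.B ⬝ (.C ⬝ .B ⬝ .B) ⬝ (.B ⬝ .B ⬝ .B))
  | ax7 : CEq (.B ⬝ (.B ⬝ .C) ⬝ (.B ⬝ .B ⬝ .B)) (.B ⬝ (.C ⬝ .B ⬝ .C) ⬝ (.B ⬝ .B ⬝ .B))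
  | ax8 : CEq (.B ⬝ (.B ⬝ .B) ⬝ .C) (.B ⬝ .C ⬝ (.B ⬝ (.B ⬝ .C) ⬝ .B))
  | axR2 : CEq (.B ⬝ .C ⬝ .C) .I
  | axR3 : CEq (.B ⬝ (.B ⬝ .C) ⬝ (.B ⬝ .C ⬝ (.B ⬝ .C))) (.B ⬝ .C ⬝ (.B ⬝ (.B ⬝ .C) ⬝ .C))

/-- Lambda terms (for the linear lambda calculus `λ_lin`). -/
inductive LT : Type
  | var : ℕ → LT
  | lam : ℕ → LT → LT
  | app : LT → LT → LT

/-- The list of free variables of a lambda term. -/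
def lfv : LT → List ℕ
  | .var x => [x]
  | .lam x M => (lfv M).erase x
  | .app M N => lfv M ++ lfv N

/-- `M` is a linear lambda term: every variable occurs exactly once. -/
def LWF : LT → Prop
  | .var _ => True
  | .lam x M => LWF M ∧ (lfv M).count x = 1
  | .app M N => LWF M ∧ LWF N ∧ ∀ x ∈ lfv M, x ∉ lfv N

/-- Substitution `M[x := N]` of lambda terms. -/
def lsubst : LT → ℕ → LT → LT
  | .var y, x, N => if y = x then N else .var y
  | .lam y M, x, N => if y = x then .lam y M else .lam y (lsubst M x N)
  | .app M₁ M₂, x, N => .app (lsubst M₁ x N) (lsubst M₂ x N)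

/-- `=βη` on lambda terms: the smallest congruence containing β and η. -/
inductive LEq : LT → LT → Prop
  | refl (M : LT) : LEq M M
  | symm {M N : LT} : LEq M N → LEq N M
  | trans {M N P : LT} : LEq M N → LEq N P → LEq M P
  | lam (x : ℕ) {M M' : LT} : LEq M M' → LEq (.lam x M) (.lam x M')
  | app {M M' N N' : LT} : LEq M M' → LEq N N' → LEq (.app M N) (.app M' N')
  | beta (x : ℕ) (M N : LT) : LEq (.app (.lam x M) N) (lsubst M x N)
  | eta (x : ℕ) (M : LT) (h : x ∉ lfv M) : LEq (.lam x (.app M (.var x))) M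

/-- `=β` on lambda terms: the smallest congruence containing β. -/
inductive LEqBeta : LT → LT → Prop
  | refl (M : LT) : LEqBeta M M
  | symm {M N : LT} : LEqBeta M N → LEqBeta N M
  | trans {M N P : LT} : LEqBeta M N → LEqBeta N P → LEqBeta M P
  | lam (x : ℕ) {M M' : LT} : LEqBeta M M' → LEqBeta (.lam x M) (.lam x M')
  | app {M M' N N' : LT} : LEqBeta M M' → LEqBeta N N' → LEqBeta (.app M N) (.app M' N')
  | beta (x : ℕ) (M N : LT) : LEqBeta (.app (.lam x M) N) (lsubst M x N)

/-- The translation `(-)♯ : BCI → λ_lin`: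
`B♯ = λxyz.x (y z)`, `C♯ = λxyz.x z y`, `I♯ = λx.x`, homomorphic on
variables and application. -/
def sharp : CT → LT
  | .var x => .var x
  | .B => .lam 1 (.lam 2 (.lam 3 (.app (.var 1) (.app (.var 2) (.var 3)))))
  | .C => .lam 1 (.lam 2 (.lam 3 (.app (.app (.var 1) (.var 3)) (.var 2))))
  | .I => .lam 1 (.var 1)
  | .app P Q => .app (sharp P) (sharp Q)

/-- Bracket abstraction `λ*x.P` (for `x` occurring exactly once in `P`):
`λ*x.x = I`; `λ*x.(P Q) = C (λ*x.P) Q` if `x` is free in `P`, and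
`λ*x.(P Q) = B P (λ*x.Q)` otherwise. -/
def lstar (x : ℕ) : CT → CT
  | .var y => if y = x then .I else .var y
  | .app P Q => if x ∈ cfv P then .C ⬝ lstar x P ⬝ Q else .B ⬝ P ⬝ lstar x Q
  | P => P

/-- The translation `(-)♭ : λ_lin → BCI`:
`x♭ = x`, `(M N)♭ = M♭ N♭`, `(λx.M)♭ = λ*x.M♭`. -/
def flat : LT → CT
  | .var x => .var x
  | .app M N => .app (flat M) (flat N)
  | .lam x M => lstar x (flat M)

end BCILin

open BCILin in
/-- The associativity law `B L (B M N) =_BCI B (B L M) N` is derivable from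
the `BCI` axioms. -/
theorem B_assoc (L M N : CT) :
    CEq (.B ⬝ L ⬝ (.B ⬝ M ⬝ N)) (.B ⬝ (.B ⬝ L ⬝ M) ⬝ N) := by
  have lhs : CEq (.B ⬝ (.B ⬝ .B) ⬝ .B ⬝ L ⬝ M ⬝ N) (.B ⬝ (.B ⬝ L ⬝ M) ⬝ N) :=
    .app (.trans (.app (.axB _ _ _) (.refl _)) (.axB _ _ _)) (.refl _)
  have rhs : CEq (.B ⬝ (.C ⬝ .B ⬝ .B) ⬝ (.B ⬝ .B ⬝ .B) ⬝ L ⬝ M ⬝ N)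
      (.B ⬝ L ⬝ (.B ⬝ M ⬝ N)) := by
    have h : CEq (.B ⬝ (.C ⬝ .B ⬝ .B) ⬝ (.B ⬝ .B ⬝ .B) ⬝ L) (.B ⬝ (.B ⬝ (.B ⬝ L)) ⬝ .B) :=
      .trans (.axB _ _ _) (.trans (.axC _ _ _)
        (.app (.app (.refl _) (.axB _ _ _)) (.refl _)))
    have h' := CEq.trans (.app h (.refl M)) (.axB _ _ _)
    exact .trans (.app h' (.refl N)) (.axB _ _ _)
  have mid := CEq.app (CEq.app (CEq.app .ax6 (.refl L)) (.refl M)) (.refl N)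
  exact .trans (.symm rhs) (.trans (.symm mid) lhs)
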